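/- In the planar case, let A = [[I_2, α_2],[−α_2, W'']] ∈ ℝ^{4×4} with W'' = diag(β₁,β₂) + I_2 symmetric (so V'' = diag(β₁,β₂)), and S_T = [[−(T/2π)A, −J_2],[J_2, −(T/2π)A]] ∈ ℝ^{8×8}. Then det(S_T − λI_8) = (d₄λ⁴ + d₃λ³ + d₂λ² + d₁λ + d₀)² where, writing c₀ = β₁β₂, c₁ = β₁+β₂+4, s = T/(2π): d₄ = 1, d₃ = c₁·s, d₂ = (c₀ + 3c₁ − 8)s² − 2, d₁ = (c₀ + c₁ − 4)·2s³ − c₁·s, d₀ = c₀·s⁴ − c₁·s² + 1. -/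

import Mathlib

open Matrix Real

/-- The rotation generator `α₂ = [[0,-1],[1,0]]`. -/
def alpha2 : Matrix (Fin 2) (Fin 2) ℝ := !![0, -1; 1, 0]

/-- The standard symplectic matrix `J₂ = [[0,-I₂],[I₂,0]] ∈ ℝ^{4×4}`. -/
def symplJ2 : Matrix (Fin 2 ⊕ Fin 2) (Fin 2 ⊕ Fin 2) ℝ :=
  Matrix.fromBlocks 0 (-1) 1 0

/-- `A = [[I₂, α₂],[-α₂, W'']]` with `W'' = diag(β₁,β₂) + I₂`. -/
noncomputable def matA (β₁ β₂ : ℝ) : Matrix (Fin 2 ⊕ Fin 2) (Fin 2 ⊕ Fin 2) ℝ :=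
  Matrix.fromBlocks 1 alpha2 (-alpha2) (Matrix.diagonal ![β₁, β₂] + 1)

/-- `S_T = [[-(T/2π)A, -J₂],[J₂, -(T/2π)A]] ∈ ℝ^{8×8}`. -/
noncomputable def matST (β₁ β₂ T : ℝ) :
    Matrix ((Fin 2 ⊕ Fin 2) ⊕ (Fin 2 ⊕ Fin 2)) ((Fin 2 ⊕ Fin 2) ⊕ (Fin 2 ⊕ Fin 2)) ℝ :=
  Matrix.fromBlocks (-(T / (2 * π)) • matA β₁ β₂) (-symplJ2) symplJ2
    (-(T / (2 * π)) • matA β₁ β₂)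

/-- `det [[B,-J],[J,B]] = det (B + iJ) det (B - iJ)` over `ℂ`. -/
theorem det_complex_blocks {n : Type*} [Fintype n] [DecidableEq n] (B J : Matrix n n ℂ) :
    (Matrix.fromBlocks B (-J) J B).det
      = (B + Complex.I • J).det * (B + (-Complex.I) • J).det := by
  have h : Matrix.fromBlocks 1 (Complex.I • (1 : Matrix n n ℂ)) 0 1 * Matrix.fromBlocks B (-J) J B
      * Matrix.fromBlocks 1 (-Complex.I • (1 : Matrix n n ℂ)) 0 1
      = Matrix.fromBlocks (B + Complex.I • J) 0 J (B + (-Complex.I) • J) := by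
    simp only [Matrix.fromBlocks_multiply]
    congr 1
    · simp
    · simp [smul_smul, smul_add]
      abel
    · simp
    · simp [add_comm]
  have h2 := congrArg Matrix.det h
  rw [Matrix.det_mul, Matrix.det_mul, Matrix.det_fromBlocks_zero₂₁, Matrix.det_fromBlocks_zero₂₁,
    Matrix.det_fromBlocks_zero₁₂] at h2
  simpa using h2

/-- The explicit `4 × 4` complex determinant; `e = ±i`. -/
theorem det_four (b c s l e : ℂ) (he : e ^ 2 = -1) :
    (Matrix.fromBlocks ((-(s + l)) • (1 : Matrix (Fin 2) (Fin 2) ℂ)) !![-e, s; -s, -e]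
      !![e, -s; s, e] !![-(s * (b + 1) + l), 0; 0, -(s * (c + 1) + l)]).det
      = ((s + l) * (s * (b + 1) + l) - s ^ 2 - 1) * ((s + l) * (s * (c + 1) + l) - s ^ 2 - 1)
        - 4 * s ^ 2 := by
  rw [← Matrix.det_reindex_self finSumFinEquiv]
  have : (Matrix.reindex finSumFinEquiv finSumFinEquiv) (Matrix.fromBlocks
      ((-(s + l)) • (1 : Matrix (Fin 2) (Fin 2) ℂ)) !![-e, s; -s, -e]
      !![e, -s; s, e] !![-(s * (b + 1) + l), 0; 0, -(s * (c + 1) + l)])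
      = !![-(s + l), 0, -e, s; 0, -(s + l), -s, -e; e, -s, -(s * (b + 1) + l), 0;
        s, e, 0, -(s * (c + 1) + l)] := by
    ext i j
    fin_cases i <;> fin_cases j <;> simp [finSumFinEquiv, Fin.addCases]
  rw [this]
  simp [Matrix.det_succ_row_zero, Fin.sum_univ_succ, Fin.succAbove]
  have h4 : e ^ 4 = 1 := by linear_combination (e ^ 2 - 1) * he
  ring_nf
  simp only [he, h4]
  ring

theorem charpoly_matST_planar (β₁ β₂ T : ℝ) (hT : 0 < T) (lam : ℝ) :
    (matST β₁ β₂ T - lam • 1).det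
      = (let c₀ := β₁ * β₂
         let c₁ := β₁ + β₂ + 4
         let s := T / (2 * π)
         1 * lam ^ 4 + (c₁ * s) * lam ^ 3 + ((c₀ + 3 * c₁ - 8) * s ^ 2 - 2) * lam ^ 2
           + ((c₀ + c₁ - 4) * 2 * s ^ 3 - c₁ * s) * lam
           + (c₀ * s ^ 4 - c₁ * s ^ 2 + 1)) ^ 2 := by
  unfold matST
  generalize T / (2 * π) = s
  have hM : (Matrix.fromBlocks (-s • matA β₁ β₂) (-symplJ2) symplJ2 (-s • matA β₁ β₂)
        - lam • (1 : Matrix ((Fin 2 ⊕ Fin 2) ⊕ (Fin 2 ⊕ Fin 2)) _ ℝ)).map Complex.ofRealHom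
      = Matrix.fromBlocks ((-s • matA β₁ β₂ - lam • 1).map Complex.ofRealHom)
        (-(symplJ2.map Complex.ofRealHom)) (symplJ2.map Complex.ofRealHom)
        ((-s • matA β₁ β₂ - lam • 1).map Complex.ofRealHom) := by
    ext i j
    rcases i with i | i <;> rcases j with j | j <;> simp [Matrix.one_apply]
  have key : ∀ e : ℂ, (-s • matA β₁ β₂ - lam • 1).map Complex.ofRealHom
        + e • symplJ2.map Complex.ofRealHom
      = Matrix.fromBlocks ((-((s : ℂ) + lam)) • (1 : Matrix (Fin 2) (Fin 2) ℂ))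
        !![-e, (s : ℂ); -s, -e] !![e, -(s : ℂ); s, e]
        !![-((s : ℂ) * (β₁ + 1) + lam), 0; 0, -((s : ℂ) * (β₂ + 1) + lam)] := by
    intro e
    ext i j
    rcases i with i | i <;> rcases j with j | j <;> fin_cases i <;> fin_cases j <;>
      simp [matA, symplJ2, alpha2] <;> ring
  apply Complex.ofRealHom.injective
  rw [RingHom.map_det, RingHom.mapMatrix_apply, hM, det_complex_blocks,
    key, key, det_four _ _ _ _ _ (by simp), det_four _ _ _ _ _ (by simp)]
  simp
  ring
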